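/- For every n ≥ 1, all s₁, s₂ > 0, and every f ∈ L²₀(π) with ‖f‖_osc < ∞, ℰ(P_∞, f) ≤ s₁s₂·ℰ(P_n, f) + ( β_{1,n}(s₁) + s₁·β_{2,n}(s₂) )·‖f‖_osc², where β_{1,n}(s) := ∫∫ 1{ h_n(x,y) ≤ 1/s } q^w(x,y) π(x) dy dx with h_n(x,y) := ∫_{(ℝ^d)^{n−1}} [ n/(ϖ(x,y) + Σ_{i=2}^n ϖ(x,y_i)) ] Π_{i=2}^n q(x,y_i) dy_i, and β_{2,n}(s) := ∫∫ 1{ ζ_n(x,y) ≤ 1/s } p̃_n(x,y) π(x) dx dy with ζ_n(x,y) := ∫_{(ℝ^d)^{n−1}} ∫_{(ℝ^d)^{n−1}} min{ (q̃w)_n(x,y)·n/(w(x,y) + Σ_{i=2}^n w(x,y_i)), (q̃w)_n(y,x)·n/(w(y,x) + Σ_{i=2}^n w(y,z_i)) } Π_{i=2}^n q(x,y_i) dy_i Π_{i=2}^n q(y,z_i) dz_i. -/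

import Mathlib

open MeasureTheory ENNReal Finset

noncomputable section

/-- `ℝ^d` with Lebesgue measure. -/
abbrev Rd (d : ℕ) := Fin d → ℝ

variable {d : ℕ}

/-- `(qw)(x) = ∫ q(x,y) w(x,y) dy`. -/
def qwInt (q w : Rd d → Rd d → ℝ) (x : Rd d) : ℝ := ∫ y, q x y * w x y

/-- The importance weights `ϖ(x,y) = w(x,y)/(qw)(x)`. -/
def impW (q w : Rd d → Rd d → ℝ) (x y : Rd d) : ℝ := w x y / qwInt q w x

/-- `r(x,y) = (π(y) q(y,x) w(y,x)) / (π(x) q(x,y) w(x,y))`. -/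
def accRatio (pi : Rd d → ℝ) (q w : Rd d → Rd d → ℝ) (x y : Rd d) : ℝ :=
  (pi y * q y x * w y x) / (pi x * q x y * w x y)

/-- `(q̃w)ₙ(x,y)`, the harmonic-mean normalisation of the resampling proposal. -/
def qtw (q w : Rd d → Rd d → ℝ) (n : ℕ) (x y : Rd d) : ℝ :=
  (∫ ys : Fin (n - 1) → Rd d,
    ((w x y + ∑ i, w x (ys i)) / n)⁻¹ * ∏ i, q x (ys i))⁻¹

/-- Off-diagonal transition density of the semi-ideal kernel `P̃ₙ`. -/
def pSemi (pi : Rd d → ℝ) (q w : Rd d → Rd d → ℝ) (n : ℕ) (x y : Rd d) : ℝ :=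
  q x y * w x y *
    min (qtw q w n x y)⁻¹ (accRatio pi q w x y / qtw q w n y x)

/-- Off-diagonal transition density of the Multiple-try Metropolis kernel `Pₙ`. -/
def pMTM (pi : Rd d → ℝ) (q w : Rd d → Rd d → ℝ) (n : ℕ) (x y : Rd d) : ℝ :=
  q x y * w x y *
    ∫ ys : Fin (n - 1) → Rd d, ∫ zs : Fin (n - 1) → Rd d,
      min ((n : ℝ) / (w x y + ∑ i, w x (ys i)))
          (accRatio pi q w x y * n / (w y x + ∑ i, w y (zs i))) *
        ((∏ i, q x (ys i)) * ∏ i, q y (zs i))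

/-- Off-diagonal transition density of the ideal kernel `P_∞`. -/
def pIdeal (pi : Rd d → ℝ) (q w : Rd d → Rd d → ℝ) (x y : Rd d) : ℝ :=
  q x y * w x y / qwInt q w x *
    min 1 (accRatio pi q w x y * qwInt q w x / qwInt q w y)

/-- The Dirichlet form `ℰ(P,f) = (1/2) ∫∫ (f(x) - f(y))² p(x,y) π(x) dx dy`
of a kernel with off-diagonal density `p`. -/
def dform (pi : Rd d → ℝ) (p : Rd d → Rd d → ℝ) (f : Rd d → ℝ) : ℝ≥0∞ :=
  (1 / 2 : ℝ≥0∞) * ∫⁻ x, ∫⁻ y, ENNReal.ofReal ((f x - f y) ^ 2 * p x y * pi x)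

/-- The probability measure with density `π` with respect to Lebesgue measure. -/
def piMeasure (pi : Rd d → ℝ) : Measure (Rd d) :=
  volume.withDensity fun x => ENNReal.ofReal (pi x)

/-- The oscillation seminorm `‖f‖_osc = esssup_π f - essinf_π f`, expressed in
`ℝ≥0∞` as the essential supremum of `(f(x) - f(y))⁺` under `π ⊗ π`. -/
def oscSeminorm (pi : Rd d → ℝ) (f : Rd d → ℝ) : ℝ≥0∞ :=
  essSup (fun p : Rd d × Rd d => ENNReal.ofReal (f p.1 - f p.2))
    ((piMeasure pi).prod (piMeasure pi))

/-- `hₙ(x,y) = ∫ n/(ϖ(x,y) + Σᵢ ϖ(x,yᵢ)) Πᵢ q(x,yᵢ) dyᵢ`. -/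
def hFun (q w : Rd d → Rd d → ℝ) (n : ℕ) (x y : Rd d) : ℝ :=
  ∫ ys : Fin (n - 1) → Rd d,
    ((n : ℝ) / (impW q w x y + ∑ i, impW q w x (ys i))) * ∏ i, q x (ys i)

/-- `β₁ₙ(s) = ∫∫ 1{hₙ(x,y) ≤ 1/s} q^w(x,y) π(x) dy dx`. -/
def beta1 (pi : Rd d → ℝ) (q w : Rd d → Rd d → ℝ) (n : ℕ) (s : ℝ) : ℝ≥0∞ :=
  ∫⁻ x, ∫⁻ y,
    if hFun q w n x y ≤ 1 / s then
      ENNReal.ofReal (q x y * w x y / qwInt q w x * pi x)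
    else 0

/-- `ζₙ(x,y)`, the conditional expectation of the minimum of the two normalisation
ratios appearing in the Multiple-try acceptance probability. -/
def zetaFun (q w : Rd d → Rd d → ℝ) (n : ℕ) (x y : Rd d) : ℝ :=
  ∫ ys : Fin (n - 1) → Rd d, ∫ zs : Fin (n - 1) → Rd d,
    min (qtw q w n x y * n / (w x y + ∑ i, w x (ys i)))
        (qtw q w n y x * n / (w y x + ∑ i, w y (zs i))) *
      ((∏ i, q x (ys i)) * ∏ i, q y (zs i))

/-- `β₂ₙ(s) = ∫∫ 1{ζₙ(x,y) ≤ 1/s} p̃ₙ(x,y) π(x) dx dy`. -/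
def beta2 (pi : Rd d → ℝ) (q w : Rd d → Rd d → ℝ) (n : ℕ) (s : ℝ) : ℝ≥0∞ :=
  ∫⁻ x, ∫⁻ y,
    if zetaFun q w n x y ≤ 1 / s then
      ENNReal.ofReal (pSemi pi q w n x y * pi x)
    else 0

lemma ofReal_sub_sq_le_oscSeminorm {pi : Rd d → ℝ} (hpi_meas : Measurable pi)
    (hpi_pos : ∀ x, 0 < pi x) (f : Rd d → ℝ) :
    ∀ᵐ x : Rd d, ∀ᵐ y : Rd d, ENNReal.ofReal ((f x - f y) ^ 2) ≤ oscSeminorm pi f ^ 2 := by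
  have hac : (volume : Measure (Rd d)) ≪ piMeasure pi :=
    withDensity_absolutelyContinuous' hpi_meas.ennreal_ofReal.aemeasurable
      (.of_forall fun x => by simp [hpi_pos x])
  have : SFinite (piMeasure pi) := by unfold piMeasure; infer_instance
  have h : ∀ᵐ p ∂(volume : Measure (Rd d)).prod (volume : Measure (Rd d)),
      ENNReal.ofReal (f p.1 - f p.2) ≤ oscSeminorm pi f :=
    (hac.prod hac).ae_le
      (ENNReal.ae_le_essSup fun p : Rd d × Rd d => ENNReal.ofReal (f p.1 - f p.2))
  have h_swap : ∀ᵐ p ∂(volume : Measure (Rd d)).prod (volume : Measure (Rd d)),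
      ENNReal.ofReal (f p.2 - f p.1) ≤ oscSeminorm pi f :=
    Measure.measurePreserving_swap.quasiMeasurePreserving.ae h
  refine Measure.ae_ae_of_ae_prod
    (p := fun p => ENNReal.ofReal ((f p.1 - f p.2) ^ 2) ≤ oscSeminorm pi f ^ 2) ?_
  filter_upwards [h, h_swap] with p hp hp_swap
  rcases le_total (f p.1) (f p.2) with hle | hle
  · rw [← neg_sq, neg_sub, ENNReal.ofReal_pow (sub_nonneg.2 hle)]
    gcongr
  · rw [ENNReal.ofReal_pow (sub_nonneg.2 hle)]
    gcongr

/-- A comparison of off-diagonal densities up to a symmetrised error term gives a comparison of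
Dirichlet forms. -/
lemma dform_le_of_density_le {pi : Rd d → ℝ} (hpi_meas : Measurable pi)
    (hpi_pos : ∀ x, 0 < pi x) {p₁ p₂ : Rd d → Rd d → ℝ} {s : ℝ≥0∞} {b : Rd d → Rd d → ℝ≥0∞}
    (hb : Measurable (Function.uncurry b)) (hs : s ≠ ∞)
    (h : ∀ x y, ENNReal.ofReal (p₁ x y * pi x) ≤
      s * ENNReal.ofReal (p₂ x y * pi x) + (b x y + b y x)) (f : Rd d → ℝ) :
    dform pi p₁ f ≤ s * dform pi p₂ f + (∫⁻ x, ∫⁻ y, b x y) * oscSeminorm pi f ^ 2 := by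
  set C := oscSeminorm pi f ^ 2
  have hb_swap : Measurable (Function.uncurry fun x y => b y x) := hb.comp measurable_swap
  have h_bound : ∀ᵐ x : Rd d, ∀ᵐ y : Rd d,
      ENNReal.ofReal ((f x - f y) ^ 2 * p₁ x y * pi x) ≤
        s * ENNReal.ofReal ((f x - f y) ^ 2 * p₂ x y * pi x) + (b x y + b y x) * C := by
    filter_upwards [ofReal_sub_sq_le_oscSeminorm hpi_meas hpi_pos f] with x hx
    filter_upwards [hx] with y hy
    rw [mul_assoc, mul_assoc, ENNReal.ofReal_mul (sq_nonneg _), ENNReal.ofReal_mul (sq_nonneg _)]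
    calc _ ≤ ENNReal.ofReal ((f x - f y) ^ 2) *
          (s * ENNReal.ofReal (p₂ x y * pi x) + (b x y + b y x)) := by gcongr; exact h x y
      _ = s * (ENNReal.ofReal ((f x - f y) ^ 2) * ENNReal.ofReal (p₂ x y * pi x)) +
          (b x y + b y x) * ENNReal.ofReal ((f x - f y) ^ 2) := by ring
      _ ≤ _ := by gcongr
  have h_left (x : Rd d) : Measurable fun y => b x y := hb.of_uncurry_left
  have h_right (x : Rd d) : Measurable fun y => b y x := hb_swap.of_uncurry_left
  have h_int_left : Measurable fun x => ∫⁻ y, b x y := hb.lintegral_prod_right'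
  have h_int_right : Measurable fun x => ∫⁻ y, b y x := hb_swap.lintegral_prod_right'
  have h_error : ∫⁻ x, ∫⁻ y, (b x y + b y x) * C = 2 * (∫⁻ x, ∫⁻ y, b x y) * C := by
    have h_inner (x : Rd d) :
        ∫⁻ y, (b x y + b y x) * C = ((∫⁻ y, b x y) + ∫⁻ y, b y x) * C := by
      rw [lintegral_mul_const _ (by fun_prop), lintegral_add_left (h_left x)]
    simp_rw [h_inner]
    rw [lintegral_mul_const _ (by fun_prop), lintegral_add_left h_int_left,
      lintegral_lintegral_swap hb_swap.aemeasurable, two_mul]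
  have h_lintegral : ∫⁻ x, ∫⁻ y, ENNReal.ofReal ((f x - f y) ^ 2 * p₁ x y * pi x) ≤
      s * (∫⁻ x, ∫⁻ y, ENNReal.ofReal ((f x - f y) ^ 2 * p₂ x y * pi x)) +
        2 * (∫⁻ x, ∫⁻ y, b x y) * C := by
    have h_err_meas : Measurable fun x => ∫⁻ y, (b x y + b y x) * C :=
      ((hb.add hb_swap).mul_const C).lintegral_prod_right'
    calc _ ≤ ∫⁻ x, ∫⁻ y, (s * ENNReal.ofReal ((f x - f y) ^ 2 * p₂ x y * pi x) +
            (b x y + b y x) * C) :=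
          lintegral_mono_ae (h_bound.mono fun x hx => lintegral_mono_ae hx)
      _ = s * (∫⁻ x, ∫⁻ y, ENNReal.ofReal ((f x - f y) ^ 2 * p₂ x y * pi x)) +
            ∫⁻ x, ∫⁻ y, (b x y + b y x) * C := by
          rw [← lintegral_const_mul' _ _ hs, ← lintegral_add_right _ h_err_meas]
          refine lintegral_congr fun x => ?_
          rw [← lintegral_const_mul' _ _ hs, ← lintegral_add_right _ (by fun_prop)]
      _ = _ := by rw [h_error]
  unfold dform
  calc _ ≤ (1 / 2 : ℝ≥0∞) * (s * (∫⁻ x, ∫⁻ y,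
          ENNReal.ofReal ((f x - f y) ^ 2 * p₂ x y * pi x)) +
            2 * (∫⁻ x, ∫⁻ y, b x y) * C) := by gcongr
    _ = s * ((1 / 2 : ℝ≥0∞) * ∫⁻ x, ∫⁻ y,
          ENNReal.ofReal ((f x - f y) ^ 2 * p₂ x y * pi x)) +
            ((1 / 2 : ℝ≥0∞) * 2) * ((∫⁻ x, ∫⁻ y, b x y) * C) := by ring
    _ = _ := by rw [one_div, ENNReal.inv_mul_cancel two_ne_zero ofNat_ne_top, one_mul]

section Densities

variable {q w : Rd d → Rd d → ℝ}

lemma integrable_prod_apply {g : Rd d → ℝ} (hg : Integrable g) (m : ℕ) :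
    Integrable fun ys : Fin m → Rd d => ∏ i, g (ys i) :=
  Integrable.fintype_prod fun _ => hg

lemma qwInt_pos (hq_pos : ∀ x y, 0 < q x y) (hw_pos : ∀ x y, 0 < w x y)
    (hqw_int : ∀ x, Integrable fun y => q x y * w x y) (x : Rd d) : 0 < qwInt q w x := by
  have h_pos (y : Rd d) : 0 < q x y * w x y := mul_pos (hq_pos x y) (hw_pos x y)
  refine (integral_pos_iff_support_of_nonneg (fun y => (h_pos y).le) (hqw_int x)).2 ?_
  rw [Function.support_eq_univ fun y => (h_pos y).ne']
  exact NeZero.pos _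

lemma inv_qtw (n : ℕ) (x y : Rd d) :
    (qtw q w n x y)⁻¹ = ∫ ys : Fin (n - 1) → Rd d,
      (n : ℝ) / (w x y + ∑ i, w x (ys i)) * ∏ i, q x (ys i) := by
  simp only [qtw, inv_inv, inv_div]

lemma hFun_eq (n : ℕ) (x y : Rd d) : hFun q w n x y = qwInt q w x * (qtw q w n x y)⁻¹ := by
  rw [inv_qtw, ← integral_const_mul]
  refine integral_congr_ae (.of_forall fun ys => ?_)
  simp only [impW, ← Finset.sum_div, ← add_div, div_div_eq_mul_div]
  ring

lemma weight_ratio_pos (hw_pos : ∀ x y, 0 < w x y) {n : ℕ} (hn : 1 ≤ n) {m : ℕ} (x y : Rd d)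
    (ys : Fin m → Rd d) : 0 < (n : ℝ) / (w x y + ∑ i, w x (ys i)) :=
  div_pos (by exact_mod_cast hn)
    (add_pos_of_pos_of_nonneg (hw_pos x y) (Finset.sum_nonneg fun i _ => (hw_pos x (ys i)).le))

lemma weight_ratio_le (hw_pos : ∀ x y, 0 < w x y) (n : ℕ) {m : ℕ} (x y : Rd d)
    (ys : Fin m → Rd d) : (n : ℝ) / (w x y + ∑ i, w x (ys i)) ≤ n / w x y := by
  have h_sum : 0 ≤ ∑ i, w x (ys i) := Finset.sum_nonneg fun i _ => (hw_pos x (ys i)).le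
  have := hw_pos x y
  gcongr
  linarith

lemma measurable_weight_ratio (hw_meas : Measurable (Function.uncurry w)) (n m : ℕ) :
    Measurable fun p : (Rd d × Rd d) × (Fin m → Rd d) =>
      (n : ℝ) / (w p.1.1 p.1.2 + ∑ i, w p.1.1 (p.2 i)) := by
  have h (i : Fin m) : Measurable fun p : (Rd d × Rd d) × (Fin m → Rd d) => w p.1.1 (p.2 i) :=
    hw_meas.comp (f := fun p : (Rd d × Rd d) × (Fin m → Rd d) => (p.1.1, p.2 i)) (by fun_prop)
  have h₀ : Measurable fun p : (Rd d × Rd d) × (Fin m → Rd d) => w p.1.1 p.1.2 :=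
    hw_meas.comp measurable_fst
  fun_prop

lemma measurable_prod_density (hq_meas : Measurable (Function.uncurry q)) (m : ℕ) :
    Measurable fun p : Rd d × (Fin m → Rd d) => ∏ i, q p.1 (p.2 i) :=
  Finset.measurable_prod _ fun i _ =>
    hq_meas.comp (f := fun p : Rd d × (Fin m → Rd d) => (p.1, p.2 i)) (by fun_prop)

lemma qtw_pos (hq_pos : ∀ x y, 0 < q x y) (hq_prob : ∀ x, (∫ y, q x y) = 1)
    (hw_meas : Measurable (Function.uncurry w)) (hw_pos : ∀ x y, 0 < w x y)
    {n : ℕ} (hn : 1 ≤ n) (x y : Rd d) : 0 < qtw q w n x y := by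
  rw [← inv_pos, inv_qtw]
  have h_pos (ys : Fin (n - 1) → Rd d) :
      0 < (n : ℝ) / (w x y + ∑ i, w x (ys i)) * ∏ i, q x (ys i) :=
    mul_pos (weight_ratio_pos hw_pos hn x y ys) (Finset.prod_pos fun i _ => hq_pos x (ys i))
  have hq_int : Integrable (q x) := .of_integral_ne_zero (by simp [hq_prob x])
  refine (integral_pos_iff_support_of_nonneg (fun ys => (h_pos ys).le) ?_).2 ?_
  · refine (integrable_prod_apply hq_int (n - 1)).bdd_mul (c := n / w x y) ?_ ?_
    · exact ((measurable_weight_ratio hw_meas n (n - 1)).comp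
        (measurable_prodMk_left (x := (x, y)))).aestronglyMeasurable
    · refine .of_forall fun ys => ?_
      rw [Real.norm_of_nonneg (weight_ratio_pos hw_pos hn x y ys).le]
      exact weight_ratio_le hw_pos n x y ys
  · rw [Function.support_eq_univ fun ys => (h_pos ys).ne']
    exact NeZero.pos _

lemma measurable_qtw (hq_meas : Measurable (Function.uncurry q))
    (hw_meas : Measurable (Function.uncurry w)) (n : ℕ) :
    Measurable (Function.uncurry (qtw q w n)) := by
  have h_integrand : Measurable fun p : (Rd d × Rd d) × (Fin (n - 1) → Rd d) =>
      (n : ℝ) / (w p.1.1 p.1.2 + ∑ i, w p.1.1 (p.2 i)) * ∏ i, q p.1.1 (p.2 i) :=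
    (measurable_weight_ratio hw_meas n _).mul ((measurable_prod_density hq_meas _).comp
      (f := fun p : (Rd d × Rd d) × (Fin (n - 1) → Rd d) => (p.1.1, p.2)) (by fun_prop))
  have h := (h_integrand.stronglyMeasurable.integral_prod_right' (ν := volume)).measurable.inv
  convert h using 1
  ext p
  simp only [Function.uncurry, Pi.inv_apply, ← inv_qtw, inv_inv]

lemma measurable_qwInt (hq_meas : Measurable (Function.uncurry q))
    (hw_meas : Measurable (Function.uncurry w)) : Measurable (qwInt q w) :=
  (hq_meas.mul hw_meas).stronglyMeasurable.integral_prod_right'.measurable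

lemma measurable_hFun (hq_meas : Measurable (Function.uncurry q))
    (hw_meas : Measurable (Function.uncurry w)) (n : ℕ) :
    Measurable (Function.uncurry (hFun q w n)) := by
  have h := ((measurable_qwInt hq_meas hw_meas).comp measurable_fst).mul
    (measurable_qtw hq_meas hw_meas n).inv
  convert h using 1
  ext p
  exact hFun_eq n p.1 p.2

lemma measurable_zetaFun (hq_meas : Measurable (Function.uncurry q))
    (hw_meas : Measurable (Function.uncurry w)) (n : ℕ) :
    Measurable (Function.uncurry (zetaFun q w n)) := by
  have ht := measurable_qtw hq_meas hw_meas n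
  have h_ratio := measurable_weight_ratio hw_meas n (n - 1)
  have hQ := measurable_prod_density hq_meas (n - 1)
  have h₁ : Measurable fun p : ((Rd d × Rd d) × (Fin (n - 1) → Rd d)) × (Fin (n - 1) → Rd d) =>
      qtw q w n p.1.1.1 p.1.1.2 * n / (w p.1.1.1 p.1.1.2 + ∑ i, w p.1.1.1 (p.1.2 i)) := by
    simp_rw [mul_div_assoc]
    exact (ht.comp measurable_fst.fst).mul
      (h_ratio.comp measurable_fst)
  have h₂ : Measurable fun p : ((Rd d × Rd d) × (Fin (n - 1) → Rd d)) × (Fin (n - 1) → Rd d) =>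
      qtw q w n p.1.1.2 p.1.1.1 * n / (w p.1.1.2 p.1.1.1 + ∑ i, w p.1.1.2 (p.2 i)) := by
    simp_rw [mul_div_assoc]
    exact (ht.comp (measurable_fst.fst.snd.prodMk measurable_fst.fst.fst)).mul
      (h_ratio.comp ((measurable_fst.fst.snd.prodMk measurable_fst.fst.fst).prodMk measurable_snd))
  have h_integrand := (h₁.min h₂).mul
    ((hQ.comp (measurable_fst.fst.fst.prodMk measurable_fst.snd)).mul
      (hQ.comp (measurable_fst.fst.snd.prodMk measurable_snd)))
  exact h_integrand.stronglyMeasurable.integral_prod_right'.integral_prod_right'.measurable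

lemma integrable_min_weight_ratio (hq_prob : ∀ x, (∫ y, q x y) = 1)
    (hw_meas : Measurable (Function.uncurry w)) (hw_pos : ∀ x y, 0 < w x y)
    {n : ℕ} (hn : 1 ≤ n) (m : ℕ) (x y : Rd d) {a b : ℝ} (ha : 0 ≤ a) (hb : 0 ≤ b) :
    Integrable (fun p : (Fin m → Rd d) × (Fin m → Rd d) =>
      min (a * n / (w x y + ∑ i, w x (p.1 i))) (b * n / (w y x + ∑ i, w y (p.2 i))) *
        ((∏ i, q x (p.1 i)) * ∏ i, q y (p.2 i))) (volume.prod volume) := by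
  have hq_int (x : Rd d) : Integrable (q x) := .of_integral_ne_zero (by simp [hq_prob x])
  have h_ratio (x y : Rd d) : Measurable fun ys : Fin m → Rd d =>
      (n : ℝ) / (w x y + ∑ i, w x (ys i)) :=
    (measurable_weight_ratio hw_meas n m).comp (measurable_prodMk_left (x := (x, y)))
  simp_rw [mul_div_assoc]
  refine ((integrable_prod_apply (hq_int x) m).mul_prod (integrable_prod_apply (hq_int y) m)).bdd_mul
    (c := a * (n / w x y)) ?_ ?_
  · exact ((((h_ratio x y).comp measurable_fst).const_mul a).min
      (((h_ratio y x).comp measurable_snd).const_mul b)).aestronglyMeasurable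
  · refine .of_forall fun p => ?_
    rw [Real.norm_of_nonneg (le_min (mul_nonneg ha (weight_ratio_pos hw_pos hn x y p.1).le)
      (mul_nonneg hb (weight_ratio_pos hw_pos hn y x p.2).le))]
    exact (min_le_left _ _).trans
      (mul_le_mul_of_nonneg_left (weight_ratio_le hw_pos n x y p.1) ha)

variable {pi : Rd d → ℝ}

lemma accRatio_pos (hpi_pos : ∀ x, 0 < pi x) (hq_pos : ∀ x y, 0 < q x y)
    (hw_pos : ∀ x y, 0 < w x y) (x y : Rd d) : 0 < accRatio pi q w x y :=
  div_pos (mul_pos (mul_pos (hpi_pos y) (hq_pos y x)) (hw_pos y x))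
    (mul_pos (mul_pos (hpi_pos x) (hq_pos x y)) (hw_pos x y))

lemma measurable_pSemi (hpi_meas : Measurable pi) (hq_meas : Measurable (Function.uncurry q))
    (hw_meas : Measurable (Function.uncurry w)) (n : ℕ) :
    Measurable (Function.uncurry (pSemi pi q w n)) := by
  have ht := measurable_qtw hq_meas hw_meas n
  have h_fst : Measurable fun p : Rd d × Rd d => pi p.1 := hpi_meas.comp measurable_fst
  have h_snd : Measurable fun p : Rd d × Rd d => pi p.2 := hpi_meas.comp measurable_snd
  exact (hq_meas.mul hw_meas).mul (ht.inv.min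
    ((((h_snd.mul (hq_meas.comp measurable_swap)).mul (hw_meas.comp measurable_swap)).div
      ((h_fst.mul hq_meas).mul hw_meas)).div (ht.comp measurable_swap)))

lemma pSemi_nonneg (hpi_pos : ∀ x, 0 < pi x) (hq_pos : ∀ x y, 0 < q x y)
    (hq_prob : ∀ x, (∫ y, q x y) = 1) (hw_meas : Measurable (Function.uncurry w))
    (hw_pos : ∀ x y, 0 < w x y) {n : ℕ} (hn : 1 ≤ n) (x y : Rd d) : 0 ≤ pSemi pi q w n x y :=
  mul_nonneg (mul_pos (hq_pos x y) (hw_pos x y)).le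
    (le_min (inv_pos.2 (qtw_pos hq_pos hq_prob hw_meas hw_pos hn x y)).le
      (div_pos (accRatio_pos hpi_pos hq_pos hw_pos x y)
        (qtw_pos hq_pos hq_prob hw_meas hw_pos hn y x)).le)

lemma pSemi_mul_zetaFun_le_pMTM (hpi_pos : ∀ x, 0 < pi x) (hq_pos : ∀ x y, 0 < q x y)
    (hq_prob : ∀ x, (∫ y, q x y) = 1) (hw_meas : Measurable (Function.uncurry w))
    (hw_pos : ∀ x y, 0 < w x y) {n : ℕ} (hn : 1 ≤ n) (x y : Rd d) :
    pSemi pi q w n x y * zetaFun q w n x y ≤ pMTM pi q w n x y := by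
  have ht := qtw_pos hq_pos hq_prob hw_meas hw_pos hn x y
  have ht_swap := qtw_pos hq_pos hq_prob hw_meas hw_pos hn y x
  have hr := accRatio_pos hpi_pos hq_pos hw_pos x y
  have h_zeta := integrable_min_weight_ratio hq_prob hw_meas hw_pos hn (n - 1) x y
    ht.le ht_swap.le
  have h_mtm := integrable_min_weight_ratio hq_prob hw_meas hw_pos hn (n - 1) x y
    zero_le_one hr.le
  simp only [one_mul] at h_mtm
  unfold pSemi zetaFun pMTM
  rw [mul_assoc, ← integral_prod _ h_zeta, ← integral_prod _ h_mtm]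
  refine mul_le_mul_of_nonneg_left ?_ (mul_pos (hq_pos x y) (hw_pos x y)).le
  rw [← integral_const_mul]
  refine integral_mono (h_zeta.const_mul _) h_mtm fun p => ?_
  rw [← mul_assoc]
  have hu := weight_ratio_pos hw_pos hn x y p.1
  have hv := weight_ratio_pos hw_pos hn y x p.2
  refine mul_le_mul_of_nonneg_right ?_ (mul_nonneg
    (Finset.prod_nonneg fun i _ => (hq_pos _ _).le) (Finset.prod_nonneg fun i _ => (hq_pos _ _).le))
  simp only [mul_div_assoc]
  have h_min_nonneg := le_min (mul_pos ht hu).le (mul_pos ht_swap hv).le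
  refine le_min ?_ ?_
  · calc _ ≤ (qtw q w n x y)⁻¹ * (qtw q w n x y * (n / (w x y + ∑ i, w x (p.1 i)))) :=
          mul_le_mul (min_le_left _ _) (min_le_left _ _) h_min_nonneg (inv_pos.2 ht).le
      _ = _ := inv_mul_cancel_left₀ ht.ne' _
  · calc _ ≤ accRatio pi q w x y / qtw q w n y x *
            (qtw q w n y x * (n / (w y x + ∑ i, w y (p.2 i)))) :=
          mul_le_mul (min_le_right _ _) (min_le_right _ _) h_min_nonneg (div_pos hr ht_swap).le
      _ = _ := by rw [← mul_assoc, div_mul_cancel₀ _ ht_swap.ne']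

lemma pIdeal_le_mul_pSemi (hpi_pos : ∀ x, 0 < pi x) (hq_pos : ∀ x y, 0 < q x y)
    (hw_pos : ∀ x y, 0 < w x y) (hqw_int : ∀ x, Integrable fun y => q x y * w x y)
    {n : ℕ} {s : ℝ} (hs : 0 < s) {x y : Rd d}
    (hxy : 1 / s < hFun q w n x y) (hyx : 1 / s < hFun q w n y x) :
    pIdeal pi q w x y ≤ s * pSemi pi q w n x y := by
  have hr := accRatio_pos hpi_pos hq_pos hw_pos x y
  have hqw := qwInt_pos hq_pos hw_pos hqw_int
  have h_inv {x y : Rd d} (h : 1 / s < hFun q w n x y) :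
      (qwInt q w x)⁻¹ ≤ s * (qtw q w n x y)⁻¹ := by
    rw [hFun_eq, div_lt_iff₀ hs] at h
    rw [inv_le_iff_one_le_mul₀' (hqw x)]
    linarith
  unfold pIdeal pSemi
  rw [mul_left_comm s, div_mul_eq_mul_div, mul_div_assoc]
  refine mul_le_mul_of_nonneg_left ?_ (mul_pos (hq_pos x y) (hw_pos x y)).le
  rw [mul_min_of_nonneg _ _ hs.le]
  refine le_min ?_ ?_
  · calc _ ≤ 1 / qwInt q w x := div_le_div_of_nonneg_right (min_le_left _ _) (hqw x).le
      _ ≤ _ := by rw [one_div]; exact h_inv hxy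
  · calc _ ≤ accRatio pi q w x y * qwInt q w x / qwInt q w y / qwInt q w x :=
          div_le_div_of_nonneg_right (min_le_right _ _) (hqw x).le
      _ = accRatio pi q w x y * (qwInt q w y)⁻¹ := by
          have := (hqw x).ne'
          field_simp
      _ ≤ accRatio pi q w x y * (s * (qtw q w n y x)⁻¹) :=
          mul_le_mul_of_nonneg_left (h_inv hyx) hr.le
      _ = _ := by ring

lemma pIdeal_mul_le (hpi_pos : ∀ x, 0 < pi x) (hq_pos : ∀ x y, 0 < q x y)
    (hw_pos : ∀ x y, 0 < w x y) (hqw_int : ∀ x, Integrable fun y => q x y * w x y) (x y : Rd d) :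
    pIdeal pi q w x y * pi x ≤ q x y * w x y / qwInt q w x * pi x := by
  have := div_pos (mul_pos (hq_pos x y) (hw_pos x y)) (qwInt_pos hq_pos hw_pos hqw_int x)
  exact mul_le_mul_of_nonneg_right (mul_le_of_le_one_right this.le (min_le_left _ _))
    (hpi_pos x).le

lemma pIdeal_mul_le_swap (hpi_pos : ∀ x, 0 < pi x) (hq_pos : ∀ x y, 0 < q x y)
    (hw_pos : ∀ x y, 0 < w x y) (hqw_int : ∀ x, Integrable fun y => q x y * w x y) (x y : Rd d) :
    pIdeal pi q w x y * pi x ≤ q y x * w y x / qwInt q w y * pi y := by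
  have hqw := qwInt_pos hq_pos hw_pos hqw_int x
  have hqw_y := (qwInt_pos hq_pos hw_pos hqw_int y).ne'
  have hc := div_pos (mul_pos (hq_pos x y) (hw_pos x y)) hqw
  calc _ ≤ q x y * w x y / qwInt q w x *
        (accRatio pi q w x y * qwInt q w x / qwInt q w y) * pi x :=
        mul_le_mul_of_nonneg_right (mul_le_mul_of_nonneg_left (min_le_right _ _) hc.le)
          (hpi_pos x).le
    _ = _ := by
        have := hqw.ne'
        have := (hpi_pos x).ne'
        have := (hq_pos x y).ne'
        have := (hw_pos x y).ne'
        unfold accRatio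
        field_simp

end Densities

/-- Weak Poincaré comparison between the ideal kernel and the semi-ideal kernel. -/
lemma dform_pIdeal_le {pi : Rd d → ℝ} {q w : Rd d → Rd d → ℝ}
    (hpi_meas : Measurable pi) (hpi_pos : ∀ x, 0 < pi x)
    (hq_meas : Measurable (Function.uncurry q)) (hq_pos : ∀ x y, 0 < q x y)
    (hw_meas : Measurable (Function.uncurry w)) (hw_pos : ∀ x y, 0 < w x y)
    (hqw_int : ∀ x, Integrable fun y => q x y * w x y)
    (n : ℕ) {s : ℝ} (hs : 0 < s) (f : Rd d → ℝ) :
    dform pi (pIdeal pi q w) f ≤ ENNReal.ofReal s * dform pi (pSemi pi q w n) f +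
      beta1 pi q w n s * oscSeminorm pi f ^ 2 := by
  refine dform_le_of_density_le hpi_meas hpi_pos ?_ ofReal_ne_top (fun x y => ?_) f
  · exact Measurable.ite
      (measurableSet_le (measurable_hFun hq_meas hw_meas n) measurable_const)
      (((hq_meas.mul hw_meas).div ((measurable_qwInt hq_meas hw_meas).comp measurable_fst)).mul
        (hpi_meas.comp measurable_fst)).ennreal_ofReal measurable_const
  · by_cases hxy : hFun q w n x y ≤ 1 / s
    · rw [if_pos hxy]
      exact (ENNReal.ofReal_le_ofReal (pIdeal_mul_le hpi_pos hq_pos hw_pos hqw_int x y)).trans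
        (le_self_add.trans le_add_self)
    by_cases hyx : hFun q w n y x ≤ 1 / s
    · rw [if_pos hyx]
      exact (ENNReal.ofReal_le_ofReal (pIdeal_mul_le_swap hpi_pos hq_pos hw_pos hqw_int x y)).trans
        (le_add_self.trans le_add_self)
    refine le_trans ?_ le_self_add
    rw [← ENNReal.ofReal_mul hs.le, ← mul_assoc]
    exact ENNReal.ofReal_le_ofReal (mul_le_mul_of_nonneg_right
      (pIdeal_le_mul_pSemi hpi_pos hq_pos hw_pos hqw_int hs (not_le.1 hxy) (not_le.1 hyx))
      (hpi_pos x).le)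

/-- Weak Poincaré comparison between the semi-ideal kernel and the Multiple-try kernel. -/
lemma dform_pSemi_le {pi : Rd d → ℝ} {q w : Rd d → Rd d → ℝ}
    (hpi_meas : Measurable pi) (hpi_pos : ∀ x, 0 < pi x)
    (hq_meas : Measurable (Function.uncurry q)) (hq_pos : ∀ x y, 0 < q x y)
    (hq_prob : ∀ x, (∫ y, q x y) = 1)
    (hw_meas : Measurable (Function.uncurry w)) (hw_pos : ∀ x y, 0 < w x y)
    {n : ℕ} (hn : 1 ≤ n) {s : ℝ} (hs : 0 < s) (f : Rd d → ℝ) :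
    dform pi (pSemi pi q w n) f ≤ ENNReal.ofReal s * dform pi (pMTM pi q w n) f +
      beta2 pi q w n s * oscSeminorm pi f ^ 2 := by
  refine dform_le_of_density_le hpi_meas hpi_pos ?_ ofReal_ne_top (fun x y => ?_) f
  · exact Measurable.ite
      (measurableSet_le (measurable_zetaFun hq_meas hw_meas n) measurable_const)
      ((measurable_pSemi hpi_meas hq_meas hw_meas n).mul
        (hpi_meas.comp measurable_fst)).ennreal_ofReal measurable_const
  · by_cases hxy : zetaFun q w n x y ≤ 1 / s
    · rw [if_pos hxy]
      exact le_self_add.trans le_add_self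
    refine le_trans ?_ le_self_add
    rw [← ENNReal.ofReal_mul hs.le, ← mul_assoc]
    refine ENNReal.ofReal_le_ofReal (mul_le_mul_of_nonneg_right ?_ (hpi_pos x).le)
    have h_mul := pSemi_mul_zetaFun_le_pMTM hpi_pos hq_pos hq_prob hw_meas hw_pos hn x y
    have h_nonneg := pSemi_nonneg hpi_pos hq_pos hq_prob hw_meas hw_pos hn x y
    rw [← div_le_iff₀' hs, div_eq_mul_one_div]
    exact (mul_le_mul_of_nonneg_left (not_le.1 hxy).le h_nonneg).trans h_mul

/-- Chained weak Poincaré comparison between the ideal kernel `P_∞` and the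
Multiple-try kernel `Pₙ`:
`ℰ(P_∞,f) ≤ s₁ s₂ ℰ(Pₙ,f) + (β₁ₙ(s₁) + s₁ β₂ₙ(s₂)) ‖f‖_osc²`. -/
theorem ideal_vs_mtm_wpi {d : ℕ}
    (pi : Rd d → ℝ) (q w : Rd d → Rd d → ℝ)
    (hpi_meas : Measurable pi) (hpi_pos : ∀ x, 0 < pi x)
    (hpi_prob : (∫ x, pi x) = 1)
    (hq_meas : Measurable (Function.uncurry q)) (hq_pos : ∀ x y, 0 < q x y)
    (hq_prob : ∀ x, (∫ y, q x y) = 1)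
    (hw_meas : Measurable (Function.uncurry w)) (hw_pos : ∀ x y, 0 < w x y)
    (hqw_int : ∀ x, Integrable fun y => q x y * w x y)
    (n : ℕ) (hn : 1 ≤ n) (s₁ s₂ : ℝ) (hs₁ : 0 < s₁) (hs₂ : 0 < s₂)
    (f : Rd d → ℝ) (hf_meas : Measurable f)
    (hf2 : Integrable fun x => f x ^ 2 * pi x)
    (hf0 : (∫ x, f x * pi x) = 0)
    (hosc : oscSeminorm pi f < ∞) :
    dform pi (pIdeal pi q w) f ≤
      ENNReal.ofReal (s₁ * s₂) * dform pi (pMTM pi q w n) f +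
        (beta1 pi q w n s₁ + ENNReal.ofReal s₁ * beta2 pi q w n s₂) *
          (oscSeminorm pi f) ^ 2 := by
  calc dform pi (pIdeal pi q w) f
      ≤ ENNReal.ofReal s₁ * dform pi (pSemi pi q w n) f +
          beta1 pi q w n s₁ * oscSeminorm pi f ^ 2 :=
        dform_pIdeal_le hpi_meas hpi_pos hq_meas hq_pos hw_meas hw_pos hqw_int n hs₁ f
    _ ≤ ENNReal.ofReal s₁ * (ENNReal.ofReal s₂ * dform pi (pMTM pi q w n) f +
          beta2 pi q w n s₂ * oscSeminorm pi f ^ 2) +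
          beta1 pi q w n s₁ * oscSeminorm pi f ^ 2 := by
        gcongr
        exact dform_pSemi_le hpi_meas hpi_pos hq_meas hq_pos hq_prob hw_meas hw_pos hn hs₂ f
    _ = _ := by
        rw [ENNReal.ofReal_mul hs₁.le]
        ring

end
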